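/- Let N ≥ 3, let the weights ψ be row-stochastic and positive, let λτ ≤ 1, and let x be a solution of the transmission-delay system. Assume there exist T_0 > 0 and fixed indices I, J with d_x(t) = |x_I(t) − x_J(t)| for all t ≥ T_0. Set γ := 1 − (N−2)·min_{i≠j} ψ_{ij}, Ψ^i(t) := Σ_{j ≠ i} ψ_{ij} x_j(t), and define the functional L(t) := (1/2)| (x_I(t) − λτ Ψ^I(t−τ)) − (x_J(t) − λτ Ψ^J(t−τ)) |² + [ (1+λτ)/(2γ) − λτ ] γ² ∫_{t−τ}^t d_x(s)² ds. Then for every t > T_0, L is differentiable at t and L'(t) ≤ −(1−γ)(1−λτγ) d_x(t)². -/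

import Mathlib

open Finset

/-- The maximum opinion discord `d_x(t) = max_{i,j} |x_i(t) - x_j(t)|`. -/
noncomputable def maxDiscord {N d : ℕ} (x : Fin N → ℝ → EuclideanSpace ℝ (Fin d)) (t : ℝ) : ℝ :=
  ⨆ p : Fin N × Fin N, ‖x p.1 t - x p.2 t‖

/-- `Ψ^i(t) = Σ_{j ≠ i} ψ_{ij} x_j(t)`. -/
noncomputable def Psi {N d : ℕ} (ψ : Fin N → Fin N → ℝ)
    (x : Fin N → ℝ → EuclideanSpace ℝ (Fin d)) (i : Fin N) (t : ℝ) : EuclideanSpace ℝ (Fin d) :=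
  ∑ j ∈ Finset.univ.erase i, ψ i j • x j t

/-- The minimal off-diagonal communication weight `min_{i ≠ j} ψ_{ij}` (for `N ≥ 3`). -/
noncomputable def minWeight {N : ℕ} (hN : 3 ≤ N) (ψ : Fin N → Fin N → ℝ) : ℝ :=
  (Finset.univ.filter fun p : Fin N × Fin N => p.1 ≠ p.2).inf'
    (by
      refine ⟨(⟨0, by omega⟩, ⟨1, by omega⟩), Finset.mem_filter.mpr ⟨Finset.mem_univ _, ?_⟩⟩
      simp [Fin.ext_iff])
    (fun p => ψ p.1 p.2)

theorem norm_sub_le_maxDiscord {N d : ℕ} (x : Fin N → ℝ → EuclideanSpace ℝ (Fin d)) (t : ℝ)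
    (i j : Fin N) : ‖x i t - x j t‖ ≤ maxDiscord x t :=
  le_ciSup (f := fun p : Fin N × Fin N => ‖x p.1 t - x p.2 t‖) (Set.finite_range _).bddAbove (i, j)

theorem continuousOn_maxDiscord {N d : ℕ} [NeZero N] {x : Fin N → ℝ → EuclideanSpace ℝ (Fin d)}
    {s : Set ℝ} (hx : ∀ i, ContinuousOn (x i) s) : ContinuousOn (maxDiscord x) s := by
  have h : maxDiscord x = fun t => Finset.univ.sup' Finset.univ_nonempty
      fun p : Fin N × Fin N => ‖x p.1 t - x p.2 t‖ := by
    funext t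
    rw [Finset.sup'_univ_eq_ciSup, maxDiscord]
  rw [h]
  exact ContinuousOn.finset_sup'_apply _ fun p _ => ((hx p.1).sub (hx p.2)).norm

theorem hasDerivAt_integral_sliding_window {f : ℝ → ℝ} {a τ t : ℝ} (hf : ContinuousOn f (Set.Ioi a))
    (hτ : 0 < τ) (ht : a < t - τ) :
    HasDerivAt (fun s => ∫ r in (s - τ)..s, f r) (f t - f (t - τ)) t := by
  have hwin : ∀ u v : ℝ, a < u → a < v → IntervalIntegrable f MeasureTheory.volume u v :=
    fun u v hu hv => (hf.mono fun r hr => lt_of_lt_of_le (lt_min hu hv) hr.1).intervalIntegrable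
  have hat : a < t := by linarith
  have hF : ∀ s, a < s → HasDerivAt (fun v => ∫ r in t..v, f r) (f s) s := fun s hs =>
    intervalIntegral.integral_hasDerivAt_right (hwin t s hat hs)
      (hf.stronglyMeasurableAtFilter isOpen_Ioi s hs) (hf.continuousAt (Ioi_mem_nhds hs))
  have hG := (hF t hat).sub ((hF (t - τ) ht).comp_sub_const t τ)
  refine hG.congr_of_eventuallyEq ?_
  filter_upwards [Ioi_mem_nhds (show a + τ < t by linarith)] with s hs
  have hs' : a + τ < s := hs
  exact (intervalIntegral.integral_interval_sub_left (hwin t s hat (by linarith))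
    (hwin t (s - τ) hat (by linarith))).symm

/-- Two nonnegative combinations of equal positive mass `γ` differ by at most `γ` times the
diameter of the points. -/
theorem norm_sum_smul_sub_sum_smul_le {ι E : Type*} [Fintype ι] [NormedAddCommGroup E]
    [NormedSpace ℝ E] {a b : ι → ℝ} {y : ι → E} {γ D : ℝ} (hγ : 0 < γ) (ha : ∀ k, 0 ≤ a k)
    (hb : ∀ k, 0 ≤ b k) (hsa : ∑ k, a k = γ) (hsb : ∑ k, b k = γ)
    (hD : ∀ k l, ‖y k - y l‖ ≤ D) :
    ‖∑ k, a k • y k - ∑ k, b k • y k‖ ≤ γ * D := by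
  have h : γ • (∑ k, a k • y k - ∑ k, b k • y k) = ∑ k, ∑ l, (a k * b l) • (y k - y l) := by
    simp only [smul_sub, Finset.sum_sub_distrib]
    congr 1
    · rw [Finset.smul_sum]
      refine Finset.sum_congr rfl fun k _ => ?_
      rw [← Finset.sum_smul, ← Finset.mul_sum, hsb, smul_smul, mul_comm]
    · rw [Finset.smul_sum, Finset.sum_comm]
      refine Finset.sum_congr rfl fun l _ => ?_
      rw [← Finset.sum_smul, ← Finset.sum_mul, hsa, smul_smul]
  have h2 : ‖∑ k, ∑ l, (a k * b l) • (y k - y l)‖ ≤ ∑ k, ∑ l, (a k * b l) * D := by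
    refine norm_sum_le_of_le _ fun k _ => norm_sum_le_of_le _ fun l _ => ?_
    rw [norm_smul, Real.norm_of_nonneg (mul_nonneg (ha k) (hb l))]
    exact mul_le_mul_of_nonneg_left (hD k l) (mul_nonneg (ha k) (hb l))
  have h3 : ∑ k, ∑ l, (a k * b l) * D = γ * (γ * D) := by
    simp_rw [mul_assoc, ← Finset.mul_sum, ← Finset.sum_mul, hsb, hsa]
  rw [← h, norm_smul, Real.norm_of_nonneg hγ.le, h3] at h2
  exact le_of_mul_le_mul_left h2 hγ

theorem minWeight_le {N : ℕ} (hN : 3 ≤ N) (ψ : Fin N → Fin N → ℝ) {i j : Fin N} (h : i ≠ j) :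
    minWeight hN ψ ≤ ψ i j :=
  Finset.inf'_le (f := fun p : Fin N × Fin N => ψ p.1 p.2) (b := (i, j)) (by simpa using h)

theorem minWeight_pos {N : ℕ} (hN : 3 ≤ N) {ψ : Fin N → Fin N → ℝ}
    (hψ : ∀ i j : Fin N, i ≠ j → 0 < ψ i j) : 0 < minWeight hN ψ :=
  (Finset.lt_inf'_iff _).2 fun _ hp => hψ _ _ (Finset.mem_filter.1 hp).2

theorem one_sub_minWeight_pos {N : ℕ} (hN : 3 ≤ N) {ψ : Fin N → Fin N → ℝ}
    (hψpos : ∀ i j : Fin N, i ≠ j → 0 < ψ i j)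
    (hψstoch : ∀ i : Fin N, ∑ j ∈ Finset.univ.erase i, ψ i j = 1) :
    0 < 1 - ((N : ℝ) - 2) * minWeight hN ψ := by
  have i : Fin N := ⟨0, by omega⟩
  have h : ∑ j ∈ Finset.univ.erase i, minWeight hN ψ ≤ ∑ j ∈ Finset.univ.erase i, ψ i j :=
    Finset.sum_le_sum fun j hj => minWeight_le hN ψ (Finset.ne_of_mem_erase hj).symm
  rw [hψstoch, Finset.sum_const, Finset.card_erase_of_mem (Finset.mem_univ _), Finset.card_univ,
    Fintype.card_fin, nsmul_eq_mul, Nat.cast_sub (by omega), Nat.cast_one] at h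
  linarith [minWeight_pos hN hψpos]

theorem norm_Psi_sub_Psi_le {N d : ℕ} (hN : 3 ≤ N) {ψ : Fin N → Fin N → ℝ}
    (hψpos : ∀ i j : Fin N, i ≠ j → 0 < ψ i j)
    (hψstoch : ∀ i : Fin N, ∑ j ∈ Finset.univ.erase i, ψ i j = 1)
    (x : Fin N → ℝ → EuclideanSpace ℝ (Fin d)) (I J : Fin N) (t : ℝ) :
    ‖Psi ψ x I t - Psi ψ x J t‖ ≤ (1 - ((N : ℝ) - 2) * minWeight hN ψ) * maxDiscord x t := by
  have hγ := one_sub_minWeight_pos hN hψpos hψstoch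
  rcases eq_or_ne I J with rfl | hIJ
  · rw [sub_self, norm_zero]
    exact mul_nonneg hγ.le ((norm_nonneg _).trans (norm_sub_le_maxDiscord x t I I))
  set m := minWeight hN ψ
  let c : Fin N → ℝ := fun k => if k = I ∨ k = J then 0 else m
  let a : Fin N → Fin N → ℝ := fun i k => (if k = i then 0 else ψ i k) - c k
  have hc : ∑ k, c k = ((N : ℝ) - 2) * m := by
    have h : ∀ k, c k = m - (if k = I then m else 0) - (if k = J then m else 0) := by
      intro k
      simp only [c]
      by_cases h1 : k = I
      · simp [h1, hIJ]
      · by_cases h2 : k = J <;> simp [h1, h2]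
        simp [hIJ.symm]
    simp only [h, Finset.sum_sub_distrib, Finset.sum_ite_eq', Finset.mem_univ, if_true,
      Finset.sum_const, Finset.card_univ, Fintype.card_fin, nsmul_eq_mul]
    ring
  have ha : ∀ i, i = I ∨ i = J → ∀ k, 0 ≤ a i k := by
    intro i hi k
    simp only [a, c]
    by_cases hk : k = i
    · subst hk
      simp [hi]
    · have hmk : m ≤ ψ i k := minWeight_le hN ψ (Ne.symm hk)
      have hpos := hψpos i k (Ne.symm hk)
      split_ifs <;> linarith
  have herase : ∀ {F : Type} [AddCommGroup F] (i : Fin N) (f : Fin N → F),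
      ∑ k ∈ Finset.univ.erase i, f k = ∑ k, if k = i then 0 else f k := by
    intro F _ i f
    rw [← Finset.sum_erase Finset.univ (a := i) (by simp)]
    exact Finset.sum_congr rfl fun k hk => by simp [Finset.ne_of_mem_erase hk]
  have hsum : ∀ i, ∑ k, a i k = 1 - ((N : ℝ) - 2) * m := by
    intro i
    simp only [a, Finset.sum_sub_distrib, hc, ← herase, hψstoch]
  have hPsi : ∀ i, Psi ψ x i t = ∑ k, a i k • x k t + ∑ k, c k • x k t := by
    intro i
    simp only [Psi, herase, a, ← Finset.sum_add_distrib, ← add_smul, sub_add_cancel, ite_smul,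
      zero_smul]
  rw [hPsi I, hPsi J, add_sub_add_right_eq_sub]
  exact norm_sum_smul_sub_sum_smul_le hγ (ha I (Or.inl rfl)) (ha J (Or.inr rfl)) (hsum I) (hsum J)
    fun k l => norm_sub_le_maxDiscord x t k l

theorem dissipation_inequality {κ γ u r p D : ℝ} (hκ : 0 ≤ κ) (hκ1 : κ ≤ 1) (hγ : 0 < γ)
    (hγ1 : γ ≤ 1) (hp : p ≤ u * r) (hr : 0 ≤ r) (hrD : r ≤ γ * D) :
    -u ^ 2 + (1 + κ) * p - κ * r ^ 2 + ((1 + κ) / (2 * γ) - κ) * γ ^ 2 * (u ^ 2 - D ^ 2) ≤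
      -((1 - γ) * (1 - κ * γ)) * u ^ 2 := by
  have hC : 0 ≤ (1 + κ) / (2 * γ) - κ := by
    rw [sub_nonneg, le_div_iff₀ (by positivity)]
    nlinarith
  have h1 : ((1 + κ) / (2 * γ) - κ) * r ^ 2 ≤ ((1 + κ) / (2 * γ) - κ) * (γ * D) ^ 2 :=
    mul_le_mul_of_nonneg_left (pow_le_pow_left₀ hr hrD 2) hC
  have h2 : (1 + κ) * p ≤ (1 + κ) * (u * r) := mul_le_mul_of_nonneg_left hp (by linarith)
  have h3 : 0 ≤ (1 + κ) / (2 * γ) * (γ * u - r) ^ 2 := by positivity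
  have h4 : (1 + κ) / (2 * γ) * γ = (1 + κ) / 2 := by field_simp
  have h5 : (1 + κ) / (2 * γ) * (γ * u - r) ^ 2 = (1 + κ) / 2 * (γ * u ^ 2 - 2 * u * r)
      + (1 + κ) / (2 * γ) * r ^ 2 := by
    rw [← h4]; ring
  have h6 : ((1 + κ) / (2 * γ) - κ) * γ ^ 2 * u ^ 2 =
      (1 + κ) / 2 * γ * u ^ 2 - κ * γ ^ 2 * u ^ 2 := by
    rw [← h4]; ring
  rw [h5] at h3
  linarith

/-- **Dissipation of the Lyapunov functional for the transmission-type delay system.**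
With `γ = 1 - (N-2) min ψ`, the functional `L` decays at rate at least
`(1-γ)(1-λτγ) d_x(t)²` for `t > T₀`. -/
theorem transmission_delay_lyapunov_dissipation {N d : ℕ} (hN : 3 ≤ N) (hd : 1 ≤ d)
    (τ lam : ℝ) (hτ : 0 < τ) (hlam : 0 ≤ lam) (hlamτ : lam * τ ≤ 1)
    (ψ : Fin N → Fin N → ℝ)
    (hψpos : ∀ i j : Fin N, i ≠ j → 0 < ψ i j)
    (hψstoch : ∀ i : Fin N, ∑ j ∈ Finset.univ.erase i, ψ i j = 1)
    (x xd : Fin N → ℝ → EuclideanSpace ℝ (Fin d))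
    (hderiv : ∀ i, ∀ t ∈ Set.Ici (-τ), HasDerivWithinAt (x i) (xd i t) (Set.Ici (-τ)) t)
    (hcont : ∀ i, ContinuousOn (xd i) (Set.Ici (-τ)))
    (hode : ∀ t > (0 : ℝ), ∀ i, xd i t =
      ∑ j ∈ Finset.univ.erase i, ψ i j • (x j (t - τ) + (lam * τ) • xd j (t - τ) - x i t))
    (T0 : ℝ) (hT0 : 0 < T0) (I J : Fin N)
    (hIJ : ∀ t ≥ T0, maxDiscord x t = ‖x I t - x J t‖)
    (γ : ℝ) (hγ : γ = 1 - ((N : ℝ) - 2) * minWeight hN ψ)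
    (L : ℝ → ℝ)
    (hL : ∀ t, L t =
      (1 / 2) * ‖(x I t - (lam * τ) • Psi ψ x I (t - τ)) -
          (x J t - (lam * τ) • Psi ψ x J (t - τ))‖ ^ 2 +
        ((1 + lam * τ) / (2 * γ) - lam * τ) * γ ^ 2 * ∫ s in (t - τ)..t, (maxDiscord x s) ^ 2) :
    ∀ t > T0, ∃ L' : ℝ, HasDerivAt L L' t ∧
      L' ≤ -((1 - γ) * (1 - lam * τ * γ)) * (maxDiscord x t) ^ 2 := by
  intro t ht
  have : NeZero N := ⟨by omega⟩
  have ht0 : 0 < t := hT0.trans ht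
  have hdx : ∀ i, ∀ s > -τ, HasDerivAt (x i) (xd i s) s := fun i s hs =>
    (hderiv i s (Set.mem_Ici.2 hs.le)).hasDerivAt (Ici_mem_nhds hs)
  have hdisc : ContinuousOn (fun s => maxDiscord x s ^ 2) (Set.Ioi (-τ)) :=
    (continuousOn_maxDiscord fun i s hs => (hdx i s hs).continuousAt.continuousWithinAt).pow 2
  have hwin := hasDerivAt_integral_sliding_window hdisc hτ (show -τ < t - τ by linarith)
  have hz : ∀ i, HasDerivAt (fun s => x i s - (lam * τ) • Psi ψ x i (s - τ))
      (Psi ψ x i (t - τ) - x i t) t := by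
    intro i
    have hP : HasDerivAt (fun s => Psi ψ x i (s - τ))
        (∑ j ∈ Finset.univ.erase i, ψ i j • xd j (t - τ)) t := by
      simp only [Psi]
      exact HasDerivAt.fun_sum fun j _ =>
        ((hdx j (t - τ) (by linarith)).comp_sub_const t τ).const_smul (ψ i j)
    have h := (hdx i t (by linarith)).sub (hP.const_smul (lam * τ))
    have he : xd i t - (lam * τ) • (∑ j ∈ Finset.univ.erase i, ψ i j • xd j (t - τ)) =
        Psi ψ x i (t - τ) - x i t := by
      rw [hode t ht0 i]
      simp only [smul_sub, smul_add, Finset.sum_sub_distrib, Finset.sum_add_distrib,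
        ← Finset.sum_smul, hψstoch, one_smul, Psi, Finset.smul_sum, smul_comm (lam * τ)]
      abel
    rw [← he]
    exact h
  have hmain := (((hz I).sub (hz J)).norm_sq.const_mul (1 / 2)).add
    (hwin.const_mul (((1 + lam * τ) / (2 * γ) - lam * τ) * γ ^ 2))
  have hLfun : L = fun s => (1 / 2) * ‖(x I s - (lam * τ) • Psi ψ x I (s - τ)) -
          (x J s - (lam * τ) • Psi ψ x J (s - τ))‖ ^ 2 +
        ((1 + lam * τ) / (2 * γ) - lam * τ) * γ ^ 2 *
          ∫ r in (s - τ)..s, (maxDiscord x r) ^ 2 := funext hL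
  refine ⟨_, by rw [hLfun]; exact hmain, ?_⟩
  have hγpos : 0 < γ := hγ ▸ one_sub_minWeight_pos hN hψpos hψstoch
  have hγ1 : γ ≤ 1 := by
    have hN' : (3 : ℝ) ≤ N := by exact_mod_cast hN
    have := mul_nonneg (show (0 : ℝ) ≤ N - 2 by linarith) (minWeight_pos hN hψpos).le
    linarith
  have hw := norm_Psi_sub_Psi_le hN hψpos hψstoch x I J (t - τ)
  rw [← hγ] at hw
  have hineq := dissipation_inequality (mul_nonneg hlam hτ.le) hlamτ hγpos hγ1
    (real_inner_le_norm (x I t - x J t) (Psi ψ x I (t - τ) - Psi ψ x J (t - τ)))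
    (norm_nonneg _) hw
  rw [← hIJ t ht.le] at hineq
  refine le_trans (le_of_eq ?_) hineq
  congr 1
  rw [hIJ t ht.le]
  have e1 : x I t - (lam * τ) • Psi ψ x I (t - τ) - (x J t - (lam * τ) • Psi ψ x J (t - τ)) =
      (x I t - x J t) - (lam * τ) • (Psi ψ x I (t - τ) - Psi ψ x J (t - τ)) := by
    rw [smul_sub]; abel
  have e2 : Psi ψ x I (t - τ) - x I t - (Psi ψ x J (t - τ) - x J t) =
      (Psi ψ x I (t - τ) - Psi ψ x J (t - τ)) - (x I t - x J t) := by abel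
  simp only [Pi.sub_apply]
  rw [e1, e2, ← real_inner_self_eq_norm_sq, ← real_inner_self_eq_norm_sq]
  simp only [inner_sub_left (𝕜 := ℝ) (x I t - x J t),
    inner_sub_right (𝕜 := ℝ) _ (Psi ψ x I (t - τ) - Psi ψ x J (t - τ)), real_inner_smul_left]
  rw [real_inner_comm (x I t - x J t) (Psi ψ x I (t - τ) - Psi ψ x J (t - τ))]
  ring
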